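/- arXiv:2108.09001 — 3 statements merged into one kernel-verified Lean document; each statement's English description precedes it below -/
import Mathlib

section
/- For any positive real number t, the sum over n ≤ X of τ(n)^t (where τ(n) is the number of positive divisors of n) is O_t(X (log X)^(2^t - 1)) as X → ∞. -/
section DivisorSums

open Finset Real
open ArithmeticFunction hiding log

/-- If `f ≥ 0` is submultiplicative and `∑_{n ≤ N} Λ(n) f(n) ≤ A N`, then
`log N ∑_{n ≤ N} f(n) ≤ (A + 1) N ∑_{n ≤ N} f(n) / n`. -/
theorem sum_mul_log_le_of_submultiplicative {f : ArithmeticFunction ℝ} (hf : ∀ n, 0 ≤ f n)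
    (hmul : ∀ m n, f (m * n) ≤ f m * f n) {A : ℝ}
    (hA : ∀ N : ℕ, ∑ n ∈ Ioc 0 N, vonMangoldt n * f n ≤ A * N) (N : ℕ) :
    (∑ n ∈ Ioc 0 N, f n) * log N ≤ (A + 1) * N * ∑ n ∈ Ioc 0 N, f n / n := by
  have hA0 : 0 ≤ A := by simpa using hA 1
  have hlog (n : ℕ) : f n * log n ≤ (f * pmul vonMangoldt f) n := by
    rw [← vonMangoldt_sum, mul_sum, mul_apply,
      Nat.sum_divisorsAntidiagonal' (f := fun i j ↦ f i * pmul vonMangoldt f j)]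
    refine sum_le_sum fun d hd ↦ ?_
    have h := hmul (n / d) d
    rw [Nat.div_mul_cancel (Nat.dvd_of_mem_divisors hd)] at h
    rw [pmul_apply, mul_left_comm, mul_comm]
    exact mul_le_mul_of_nonneg_left h vonMangoldt_nonneg
  have h₁ : ∑ n ∈ Ioc 0 N, f n * log n ≤ A * N * ∑ n ∈ Ioc 0 N, f n / n := by
    calc ∑ n ∈ Ioc 0 N, f n * log n ≤ ∑ n ∈ Ioc 0 N, (f * pmul vonMangoldt f) n :=
          sum_le_sum fun n _ ↦ hlog n
      _ = ∑ n ∈ Ioc 0 N, f n * ∑ m ∈ Ioc 0 (N / n), pmul vonMangoldt f m :=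
          sum_Ioc_mul_eq_sum_sum _ _ _
      _ ≤ ∑ n ∈ Ioc 0 N, f n * (A * (N / n)) := by
          refine sum_le_sum fun n _ ↦ mul_le_mul_of_nonneg_left ?_ (hf n)
          exact (hA _).trans (mul_le_mul_of_nonneg_left Nat.cast_div_le hA0)
      _ = A * N * ∑ n ∈ Ioc 0 N, f n / n := by
          rw [mul_sum]
          exact sum_congr rfl fun n _ ↦ by ring
  have h₂ : ∑ n ∈ Ioc 0 N, f n * (log N - log n) ≤ N * ∑ n ∈ Ioc 0 N, f n / n := by
    rw [mul_sum]
    refine sum_le_sum fun n hn ↦ ?_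
    obtain ⟨hn0, hnN⟩ := mem_Ioc.mp hn
    have hn' : (0 : ℝ) < n := by exact_mod_cast hn0
    have hN' : (0 : ℝ) < N := by exact_mod_cast hn0.trans_le hnN
    rw [← log_div hN'.ne' hn'.ne']
    calc f n * log (N / n) ≤ f n * (N / n) :=
          mul_le_mul_of_nonneg_left (log_le_self (by positivity)) (hf n)
      _ = N * (f n / n) := by ring
  calc (∑ n ∈ Ioc 0 N, f n) * log N
      = ∑ n ∈ Ioc 0 N, f n * log n + ∑ n ∈ Ioc 0 N, f n * (log N - log n) := by
        rw [← sum_add_distrib, sum_mul]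
        exact sum_congr rfl fun n _ ↦ by ring
    _ ≤ _ := by linarith

theorem card_divisors_mul_le (m n : ℕ) :
    (m * n).divisors.card ≤ m.divisors.card * n.divisors.card := by
  rw [Nat.divisors_mul]
  exact card_mul_le

theorem card_divisors_prime_pow {p : ℕ} (hp : p.Prime) (k : ℕ) :
    (p ^ k).divisors.card = k + 1 := by
  simp [Nat.divisors_prime_pow hp]

theorem card_divisors_le_of_isPrimePow {n : ℕ} (hn : IsPrimePow n) :
    (n.divisors.card : ℝ) ≤ log n / log 2 + 1 := by
  obtain ⟨p, k, hp, -, rfl⟩ := (isPrimePow_nat_iff n).mp hn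
  rw [card_divisors_prime_pow hp]
  have h2 : log 2 ≤ log p := log_le_log two_pos (by exact_mod_cast hp.two_le)
  push_cast
  rw [log_pow, add_le_add_iff_right, le_div_iff₀ (log_pos one_lt_two)]
  gcongr

theorem exists_forall_log_rpow_mul_sqrt_le {t : ℝ} (ht : 0 < t) :
    ∃ C : ℝ, 0 ≤ C ∧ ∀ x : ℝ, 1 ≤ x → (log x / log 2 + 1) ^ t * √x ≤ C * x := by
  have hl : 0 < log 2 := log_pos one_lt_two
  refine ⟨(2 * t / log 2 + 1) ^ t, by positivity, fun x hx ↦ ?_⟩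
  have hx0 : 0 < x := by linarith
  have h1 : 1 ≤ x ^ (1 / (2 * t)) := one_le_rpow hx (by positivity)
  have h2 : log x / log 2 + 1 ≤ (2 * t / log 2 + 1) * x ^ (1 / (2 * t)) := by
    have := log_le_rpow_div hx0.le (ε := 1 / (2 * t)) (by positivity)
    calc log x / log 2 + 1 ≤ (x ^ (1 / (2 * t)) / (1 / (2 * t))) / log 2 + x ^ (1 / (2 * t)) := by
          gcongr
      _ = _ := by field_simp
  have h3 : (x ^ (1 / (2 * t))) ^ t = √x := by
    rw [← rpow_mul hx0.le, sqrt_eq_rpow]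
    congr 1
    field_simp
  have h4 : 0 ≤ log x / log 2 + 1 := by
    have := log_nonneg hx
    positivity
  calc (log x / log 2 + 1) ^ t * √x
      ≤ ((2 * t / log 2 + 1) * x ^ (1 / (2 * t))) ^ t * √x := by gcongr
    _ = (2 * t / log 2 + 1) ^ t * (√x * √x) := by
        rw [mul_rpow (by positivity) (by positivity), h3, mul_assoc]
    _ = _ := by rw [mul_self_sqrt hx0.le]

/-- Chebyshev-type bound `∑_{n ≤ N} Λ(n) τ(n)^t ≪_t N`. -/
theorem exists_forall_sum_vonMangoldt_mul_card_divisors_rpow_le {t : ℝ} (ht : 0 < t) :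
    ∃ A : ℝ, ∀ N : ℕ,
      ∑ n ∈ Ioc 0 N, vonMangoldt n * (n.divisors.card : ℝ) ^ t ≤ A * N := by
  obtain ⟨C, hC0, hC⟩ := exists_forall_log_rpow_mul_sqrt_le ht
  obtain ⟨D, hD⟩ := Chebyshev.psi_sub_theta_le_mul_sqrt
  have hD0 : 0 ≤ D := by
    have := (sub_nonneg.mpr (Chebyshev.theta_le_psi 1)).trans (hD 1)
    simpa using this
  refine ⟨2 ^ t * (log 4 + 4) + D * C, fun N ↦ ?_⟩
  rcases N.eq_zero_or_pos with rfl | hN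
  · simp
  have hN1 : (1 : ℝ) ≤ N := by exact_mod_cast hN
  set B : ℝ := (log N / log 2 + 1) ^ t
  have hB : 0 ≤ B := by
    have := log_nonneg hN1
    have := log_nonneg one_le_two
    positivity
  have key : ∀ n ∈ Ioc 0 N, vonMangoldt n * (n.divisors.card : ℝ) ^ t ≤
      2 ^ t * vonMangoldt n + B * if ¬ n.Prime then vonMangoldt n else 0 := by
    intro n hn
    by_cases hp : n.Prime
    · have h := card_divisors_prime_pow hp 1
      rw [pow_one] at h
      simp [h, hp, mul_comm, one_add_one_eq_two]
    · rw [if_pos hp]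
      have h0 : 0 ≤ vonMangoldt n := vonMangoldt_nonneg
      rcases h0.eq_or_lt with h | h
      · simp [← h]
      have hpp := vonMangoldt_ne_zero_iff.mp h.ne'
      have hn0 : (0 : ℝ) < n := by exact_mod_cast (mem_Ioc.mp hn).1
      have hnN : (n : ℝ) ≤ N := by exact_mod_cast (mem_Ioc.mp hn).2
      have : (n.divisors.card : ℝ) ^ t ≤ B := by
        refine rpow_le_rpow (by positivity)
          ((card_divisors_le_of_isPrimePow hpp).trans ?_) ht.le
        gcongr
      have h2 : 0 ≤ (2 : ℝ) ^ t * vonMangoldt n := by positivity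
      nlinarith
  calc _ ≤ ∑ n ∈ Ioc 0 N, (2 ^ t * vonMangoldt n
          + B * if ¬ n.Prime then vonMangoldt n else 0) := sum_le_sum key
    _ = 2 ^ t * Chebyshev.psi N + B * (Chebyshev.psi N - Chebyshev.theta N) := by
        rw [sum_add_distrib, ← mul_sum, ← mul_sum, Chebyshev.psi_sub_theta_eq_sum_not_prime,
          sum_filter, Chebyshev.psi, Nat.floor_natCast]
    _ ≤ 2 ^ t * ((log 4 + 4) * N) + B * (D * √N) := by
        gcongr
        · exact Chebyshev.psi_le_const_mul_self (by positivity)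
        · exact hD N
    _ = 2 ^ t * (log 4 + 4) * N + D * (B * √N) := by ring
    _ ≤ 2 ^ t * (log 4 + 4) * N + D * (C * N) := by
        exact add_le_add_right (mul_le_mul_of_nonneg_left (hC N hN1) hD0) _
    _ = _ := by ring

theorem summable_add_three_rpow_mul_half_pow (t : ℝ) :
    Summable fun k : ℕ ↦ ((k : ℝ) + 3) ^ t * (1 / 2) ^ k := by
  have h := summable_pow_mul_geometric_of_norm_lt_one ⌈t⌉₊ (r := (1 / 2 : ℝ)) (by norm_num)
  have h := ((summable_nat_add_iff 3).mpr h).mul_left 8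
  refine Summable.of_nonneg_of_le (fun k ↦ by positivity) (fun k ↦ ?_) h
  have h1 : ((k : ℝ) + 3) ^ t ≤ ((k : ℝ) + 3) ^ ⌈t⌉₊ := by
    rw [← rpow_natCast]
    exact rpow_le_rpow_of_exponent_le (by linarith [(Nat.cast_nonneg k : (0 : ℝ) ≤ k)])
      (Nat.le_ceil t)
  push_cast
  calc ((k : ℝ) + 3) ^ t * (1 / 2) ^ k ≤ ((k : ℝ) + 3) ^ ⌈t⌉₊ * (1 / 2) ^ k := by gcongr
    _ = _ := by ring

theorem summable_add_one_rpow_mul_pow {t u : ℝ} (ht : 0 < t) (hu0 : 0 ≤ u) (hu : u ≤ 1 / 2) :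
    Summable fun k : ℕ ↦ ((k : ℝ) + 1) ^ t * u ^ k := by
  refine Summable.of_nonneg_of_le (fun k ↦ by positivity) (fun k ↦ ?_)
    (summable_add_three_rpow_mul_half_pow t)
  gcongr
  norm_num

theorem tsum_add_one_rpow_mul_pow_le {t u : ℝ} (ht : 0 < t) (hu0 : 0 ≤ u) (hu : u ≤ 1 / 2) :
    ∑' k : ℕ, ((k : ℝ) + 1) ^ t * u ^ k ≤
      exp ((∑' k : ℕ, ((k : ℝ) + 3) ^ t * (1 / 2) ^ k) * u ^ 2) * ((1 - u)⁻¹) ^ ((2 : ℝ) ^ t) := by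
  set S := ∑' k : ℕ, ((k : ℝ) + 3) ^ t * (1 / 2) ^ k
  have hs := summable_add_one_rpow_mul_pow ht hu0 hu
  have htail : ∑' k : ℕ, (((k + 2 : ℕ) : ℝ) + 1) ^ t * u ^ (k + 2) ≤ S * u ^ 2 := by
    rw [← tsum_mul_right]
    refine ((summable_nat_add_iff 2).mpr hs).tsum_le_tsum (fun k ↦ ?_)
      ((summable_add_three_rpow_mul_half_pow t).mul_right _)
    have h3 : ((k + 2 : ℕ) : ℝ) + 1 = k + 3 := by push_cast; ring
    rw [h3, pow_add, ← mul_assoc]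
    gcongr
  have hsum : ∑' k : ℕ, ((k : ℝ) + 1) ^ t * u ^ k ≤ 2 ^ t * u + S * u ^ 2 + 1 := by
    rw [← hs.sum_add_tsum_nat_add 2, sum_range_succ, sum_range_one]
    norm_num at htail ⊢
    linarith
  have hinv : exp (2 ^ t * u) ≤ ((1 - u)⁻¹) ^ ((2 : ℝ) ^ t) := by
    have h1u : 0 < 1 - u := by linarith
    rw [mul_comm, exp_mul]
    refine rpow_le_rpow (exp_pos _).le ?_ (by positivity)
    rw [← neg_neg u, exp_neg, neg_neg]
    gcongr
    linarith [add_one_le_exp (-u)]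
  calc ∑' k : ℕ, ((k : ℝ) + 1) ^ t * u ^ k ≤ exp (2 ^ t * u + S * u ^ 2) :=
        hsum.trans (add_one_le_exp _)
    _ = exp (S * u ^ 2) * exp (2 ^ t * u) := by rw [add_comm, exp_add]
    _ ≤ _ := by gcongr

theorem tsum_inv_rpow_le {s : ℝ} (hs : 1 < s) :
    ∑' n : ℕ, ((n : ℝ) ^ s)⁻¹ ≤ 1 + 1 / (s - 1) := by
  have h := ZetaAsymptotics.zeta_limit_aux1 hs
  have h0 : 0 ≤ ZetaAsymptotics.termTSum s := tsum_nonneg fun n ↦ ZetaAsymptotics.term_nonneg _ _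
  rw [(summable_nat_rpow_inv.mpr hs).tsum_eq_zero_add]
  simp only [one_div, Nat.cast_add, Nat.cast_one, Nat.cast_zero] at h ⊢
  rw [zero_rpow (by linarith)]
  nlinarith

theorem prod_primesBelow_inv_one_sub_rpow_le {s : ℝ} (hs : 1 < s) (N : ℕ) :
    ∏ p ∈ N.primesBelow, (1 - ((p : ℝ) ^ s)⁻¹)⁻¹ ≤ 1 + 1 / (s - 1) := by
  have hsum := summable_nat_rpow_inv.mpr hs
  have hprod := EulerProduct.prod_primesBelow_tsum_eq_tsum_smoothNumbers
    (f := fun n : ℕ ↦ ((n : ℝ) ^ s)⁻¹) (by simp)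
    (fun {m n} _ ↦ by rw [Nat.cast_mul, mul_rpow (by positivity) (by positivity), mul_inv])
    hsum.norm N
  have hgeom : ∏ p ∈ N.primesBelow, (1 - ((p : ℝ) ^ s)⁻¹)⁻¹ =
      ∏ p ∈ N.primesBelow, ∑' k : ℕ, (((p ^ k : ℕ) : ℝ) ^ s)⁻¹ := by
    refine prod_congr rfl fun p hp ↦ ?_
    have hp1 : (1 : ℝ) < p := by exact_mod_cast (Nat.prime_of_mem_primesBelow hp).one_lt
    rw [← tsum_geometric_of_lt_one (by positivity)
      (inv_lt_one_of_one_lt₀ (one_lt_rpow hp1 (by linarith)))]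
    refine tsum_congr fun k ↦ ?_
    rw [Nat.cast_pow, inv_pow, ← rpow_natCast, ← rpow_natCast, ← rpow_mul (by positivity),
      ← rpow_mul (by positivity), mul_comm]
  rw [hgeom, hprod]
  exact (hsum.tsum_subtype_le _ _ fun n ↦ by positivity).trans (tsum_inv_rpow_le hs)

/-- Partial sums of `∑ τ(n)^t n^{-s}` are `≪_t (1 + 1 / (s - 1))^(2^t)`, uniformly in `s > 1`. -/
theorem exists_forall_sum_card_divisors_rpow_div_rpow_le {t : ℝ} (ht : 0 < t) :
    ∃ C : ℝ, 0 < C ∧ ∀ s : ℝ, 1 < s → ∀ N : ℕ,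
      ∑ n ∈ Ioc 0 N, (n.divisors.card : ℝ) ^ t * ((n : ℝ) ^ s)⁻¹ ≤
        C * (1 + 1 / (s - 1)) ^ ((2 : ℝ) ^ t) := by
  set S := ∑' k : ℕ, ((k : ℝ) + 3) ^ t * (1 / 2) ^ k
  have hS : 0 ≤ S := tsum_nonneg fun k ↦ by positivity
  have hsq : Summable fun n : ℕ ↦ ((n : ℝ) ^ 2)⁻¹ := summable_nat_pow_inv.mpr one_lt_two
  refine ⟨exp (S * ∑' n : ℕ, ((n : ℝ) ^ 2)⁻¹), exp_pos _, fun s hs N ↦ ?_⟩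
  set f : ℕ → ℝ := fun n ↦ (n.divisors.card : ℝ) ^ t * ((n : ℝ) ^ s)⁻¹
  have hf0 (n : ℕ) : 0 ≤ f n := by positivity
  have hfp {p : ℕ} (hp : p.Prime) (k : ℕ) :
      f (p ^ k) = ((k : ℝ) + 1) ^ t * (((p : ℝ) ^ s)⁻¹) ^ k := by
    simp only [f]
    rw [card_divisors_prime_pow hp, Nat.cast_pow, inv_pow, ← rpow_natCast, ← rpow_natCast,
      ← rpow_mul (by positivity), ← rpow_mul (by positivity), mul_comm s, Nat.cast_add_one]
  have hle {p : ℕ} (hp : p.Prime) : ((p : ℝ) ^ s)⁻¹ ≤ (p : ℝ)⁻¹ := by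
    have hp1 : (1 : ℝ) ≤ p := by exact_mod_cast hp.one_le
    gcongr
    simpa using rpow_le_rpow_of_exponent_le hp1 hs.le
  have hhalf {p : ℕ} (hp : p.Prime) : ((p : ℝ) ^ s)⁻¹ ≤ 1 / 2 := by
    have hp2 : (2 : ℝ) ≤ p := by exact_mod_cast hp.two_le
    refine (hle hp).trans ?_
    rw [one_div]
    gcongr
  have hsum {p : ℕ} (hp : p.Prime) : Summable fun k : ℕ ↦ ‖f (p ^ k)‖ := by
    refine Summable.norm ?_
    simp only [hfp hp]
    exact summable_add_one_rpow_mul_pow ht (by positivity) (hhalf hp)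
  obtain ⟨-, hprod⟩ :=
    EulerProduct.summable_and_hasSum_smoothNumbers_prod_primesBelow_tsum (f := f) (by simp [f])
      (fun {m n} hmn ↦ by
        simp only [f]
        rw [hmn.card_divisors_mul, Nat.cast_mul, Nat.cast_mul,
          mul_rpow (by positivity) (by positivity), mul_rpow (by positivity) (by positivity),
          mul_inv, mul_mul_mul_comm])
      hsum (N + 1)
  have hfin : ∑ n ∈ Ioc 0 N, f n ≤ ∏ p ∈ (N + 1).primesBelow, ∑' k : ℕ, f (p ^ k) := by
    have hmem : ∀ n ∈ Ioc 0 N, n ∈ (N + 1).smoothNumbers := fun n hn ↦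
      Nat.mem_smoothNumbers_of_lt (mem_Ioc.mp hn).1 (Nat.lt_succ_of_le (mem_Ioc.mp hn).2)
    rw [← sum_subtype_of_mem f hmem]
    exact sum_le_hasSum _ (fun n _ ↦ hf0 n) hprod
  have hfactor : ∀ p ∈ (N + 1).primesBelow, 0 ≤ (1 - ((p : ℝ) ^ s)⁻¹)⁻¹ := fun p hp ↦ by
    have := hhalf (Nat.prime_of_mem_primesBelow hp)
    exact inv_nonneg.mpr (by linarith)
  have hfactors := prod_nonneg hfactor
  refine hfin.trans ?_
  calc ∏ p ∈ (N + 1).primesBelow, ∑' k : ℕ, f (p ^ k)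
      ≤ ∏ p ∈ (N + 1).primesBelow,
          exp (S * ((p : ℝ) ^ 2)⁻¹) * ((1 - ((p : ℝ) ^ s)⁻¹)⁻¹) ^ ((2 : ℝ) ^ t) := by
        refine prod_le_prod (fun p _ ↦ tsum_nonneg fun k ↦ hf0 _) fun p hp ↦ ?_
        have hp' := Nat.prime_of_mem_primesBelow hp
        simp only [hfp hp']
        have h1u : 0 < 1 - ((p : ℝ) ^ s)⁻¹ := by linarith [hhalf hp']
        refine (tsum_add_one_rpow_mul_pow_le ht (by positivity) (hhalf hp')).trans ?_
        rw [← inv_pow (p : ℝ)]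
        exact mul_le_mul_of_nonneg_right (exp_le_exp.mpr (mul_le_mul_of_nonneg_left
          (pow_le_pow_left₀ (by positivity) (hle hp') 2) hS)) (by positivity)
    _ = exp (S * ∑ p ∈ (N + 1).primesBelow, ((p : ℝ) ^ 2)⁻¹) *
          (∏ p ∈ (N + 1).primesBelow, (1 - ((p : ℝ) ^ s)⁻¹)⁻¹) ^ ((2 : ℝ) ^ t) := by
        rw [prod_mul_distrib, ← exp_sum, mul_sum, finsetProd_rpow _ _ hfactor]
    _ ≤ _ := by
        gcongr
        · exact hsq.sum_le_tsum _ fun n _ ↦ by positivity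
        · exact prod_primesBelow_inv_one_sub_rpow_le hs _

theorem exists_forall_sum_card_divisors_rpow_div_le {t : ℝ} (ht : 0 < t) :
    ∃ C : ℝ, 0 < C ∧ ∀ N : ℕ, 2 ≤ N →
      ∑ n ∈ Ioc 0 N, (n.divisors.card : ℝ) ^ t / n ≤ C * log N ^ ((2 : ℝ) ^ t) := by
  obtain ⟨C, hC, h⟩ := exists_forall_sum_card_divisors_rpow_div_rpow_le ht
  have hl2 : 0 < log 2 := log_pos one_lt_two
  refine ⟨exp 1 * C * (1 / log 2 + 1) ^ ((2 : ℝ) ^ t), by positivity, fun N hN ↦ ?_⟩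
  have hN2 : (2 : ℝ) ≤ N := by exact_mod_cast hN
  have hl : log 2 ≤ log N := log_le_log two_pos hN2
  have hl0 : 0 < log N := hl2.trans_le hl
  calc ∑ n ∈ Ioc 0 N, (n.divisors.card : ℝ) ^ t / n
      ≤ ∑ n ∈ Ioc 0 N, exp 1 * ((n.divisors.card : ℝ) ^ t * ((n : ℝ) ^ (1 + 1 / log N))⁻¹) := by
        refine sum_le_sum fun n hn ↦ ?_
        have hn0 : (0 : ℝ) < n := by exact_mod_cast (mem_Ioc.mp hn).1
        have hnN : (n : ℝ) ≤ N := by exact_mod_cast (mem_Ioc.mp hn).2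
        have he : (n : ℝ) ^ (1 / log N) ≤ exp 1 := by
          rw [rpow_def_of_pos hn0]
          gcongr
          rw [mul_one_div]
          exact div_le_one_of_le₀ (log_le_log hn0 hnN) hl0.le
        rw [rpow_add hn0, rpow_one]
        calc (n.divisors.card : ℝ) ^ t / n
            = (n : ℝ) ^ (1 / log N) *
                ((n.divisors.card : ℝ) ^ t * ((n : ℝ) * (n : ℝ) ^ (1 / log N))⁻¹) := by
              field_simp
          _ ≤ _ := by gcongr
    _ ≤ exp 1 * (C * (1 + 1 / (1 + 1 / log N - 1)) ^ ((2 : ℝ) ^ t)) := by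
        rw [← mul_sum]
        gcongr
        exact h _ (by linarith [one_div_pos.mpr hl0]) N
    _ ≤ exp 1 * (C * ((1 / log 2 + 1) * log N) ^ ((2 : ℝ) ^ t)) := by
        have h1 : 1 + 1 / (1 + 1 / log N - 1) ≤ (1 / log 2 + 1) * log N := by
          rw [add_sub_cancel_left, one_div_one_div, add_mul, one_mul, add_le_add_iff_right,
            one_div_mul_eq_div, one_le_div hl2]
          exact hl
        have h0 : 0 ≤ 1 + 1 / (1 + 1 / log N - 1) := by
          rw [add_sub_cancel_left, one_div_one_div]
          positivity
        gcongr
    _ = _ := by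
        rw [mul_rpow (by positivity) hl0.le]
        ring

end DivisorSums

/-- For any positive real `t`, `∑_{n ≤ X} τ(n)^t ≪_t X (log X)^(2^t - 1)`. -/
theorem divisor_power_sum_bound (t : ℝ) (ht : 0 < t) :
    ∃ C : ℝ, 0 < C ∧ ∀ X : ℝ, 2 ≤ X →
      ∑ n ∈ Finset.Icc 1 ⌊X⌋₊, ((n.divisors.card : ℝ)) ^ t
        ≤ C * X * Real.log X ^ ((2 : ℝ) ^ t - 1) := by
  obtain ⟨A, hA⟩ := exists_forall_sum_vonMangoldt_mul_card_divisors_rpow_le ht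
  obtain ⟨C, hC, h⟩ := exists_forall_sum_card_divisors_rpow_div_le ht
  have hA0 : 0 ≤ A := by simpa using hA 1
  let f : ArithmeticFunction ℝ :=
    ⟨fun n ↦ (n.divisors.card : ℝ) ^ t, by simp [ht.ne']⟩
  refine ⟨(A + 1) * C, by positivity, fun X hX ↦ ?_⟩
  have hN : 2 ≤ ⌊X⌋₊ := Nat.le_floor (by exact_mod_cast hX)
  have hNX : (⌊X⌋₊ : ℝ) ≤ X := Nat.floor_le (by linarith)
  generalize ⌊X⌋₊ = N at hN hNX
  have hN1 : (1 : ℝ) < N := by exact_mod_cast hN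
  have hl : 0 < Real.log N := Real.log_pos hN1
  have hmain := sum_mul_log_le_of_submultiplicative (f := f)
    (fun n ↦ by simp only [f, ArithmeticFunction.coe_mk]; positivity)
    (fun m n ↦ by
      simp only [f, ArithmeticFunction.coe_mk]
      rw [← Real.mul_rpow (by positivity) (by positivity)]
      exact Real.rpow_le_rpow (by positivity) (by exact_mod_cast card_divisors_mul_le m n) ht.le)
    hA N
  simp only [f, ArithmeticFunction.coe_mk] at hmain
  have hbound : ∑ n ∈ Finset.Ioc 0 N, (n.divisors.card : ℝ) ^ t ≤
      (A + 1) * C * N * Real.log N ^ ((2 : ℝ) ^ t - 1) := by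
    refine le_of_mul_le_mul_right (hmain.trans ?_) hl
    calc (A + 1) * N * ∑ n ∈ Finset.Ioc 0 N, (n.divisors.card : ℝ) ^ t / n
        ≤ (A + 1) * N * (C * Real.log N ^ ((2 : ℝ) ^ t)) := by
          gcongr
          exact h N hN
      _ = _ := by
          rw [Real.rpow_sub_one hl.ne']
          field_simp
  have hexp : 0 ≤ (2 : ℝ) ^ t - 1 := sub_nonneg.mpr (Real.one_le_rpow one_le_two ht.le)
  calc ∑ n ∈ Finset.Icc 1 N, (n.divisors.card : ℝ) ^ t
      = ∑ n ∈ Finset.Ioc 0 N, (n.divisors.card : ℝ) ^ t := rfl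
    _ ≤ _ := hbound
    _ ≤ _ := by gcongr
end

section
/- Let L/K be a Galois extension of number fields with Galois group S_3, let L_3 be a cubic subextension and L_2 the unique quadratic subextension of L/K. Then D_L · D_K^2 = D_{L_3}^2 · D_{L_2} (absolute discriminants). -/
open NumberField
open scoped Pointwise

section Inertia

variable {G R : Type*} [Group G] [CommRing R] [MulSemiringAction G R]

/-- An element of the inertia group of order dividing `m ∉ P`, acting trivially on `P / P ^ 2`,
acts trivially. -/
lemma smul_eq_self_of_mem_inertia [IsDedekindDomain R] {P : Ideal R} [hP : P.IsPrime]
    {g : G} (hg : g ∈ P.inertia G) (hg2 : ∀ x ∈ P, g • x - x ∈ P ^ 2)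
    {m : ℕ} (hgm : g ^ m = 1) (hm : (m : R) ∉ P) (x : R) : g • x = x := by
  have step (k : ℕ) : ∀ x ∈ P ^ k, g • x - x ∈ P ^ (k + 1) := by
    induction k with
    | zero => exact fun x _ ↦ by simpa using hg x
    | succ k ih =>
      intro x hx
      rw [pow_succ] at hx
      refine Submodule.mul_induction_on hx (fun a ha b hb ↦ ?_) (fun a b ha hb ↦ ?_)
      · have hgb : g • b ∈ P := by
          have := P.add_mem (Ideal.pow_le_self two_ne_zero (hg2 b hb)) hb
          rwa [sub_add_cancel] at this
        have key : g • (a * b) - a * b = (g • a - a) * g • b + a * (g • b - b) := by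
          rw [smul_mul']; ring
        rw [key]
        refine Ideal.add_mem _ ?_ ?_
        · rw [pow_succ]; exact Ideal.mul_mem_mul (ih a ha) hgb
        · rw [add_assoc, pow_add]; exact Ideal.mul_mem_mul ha (hg2 b hb)
      · rw [smul_add, add_sub_add_comm]
        exact Ideal.add_mem _ ha hb
  have main (k : ℕ) : ∀ x, g • x - x ∈ P ^ (k + 1) := by
    induction k with
    | zero => exact fun x ↦ by simpa using hg x
    | succ k ih =>
      intro x
      have iter (i : ℕ) : g ^ i • x - x - i * (g • x - x) ∈ P ^ (k + 1 + 1) := by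
        induction i with
        | zero => simp
        | succ i hi =>
          have h1 : g • (g ^ i • x - x) - (g ^ i • x - x) ∈ P ^ (k + 1 + 1) := by
            refine step _ _ ?_
            have := Ideal.add_mem _ (Ideal.pow_le_pow_right (Nat.le_succ _) hi)
              (Ideal.mul_mem_left _ (i : R) (ih x))
            simpa using this
          have := Ideal.add_mem _ h1 hi
          rw [smul_sub, smul_smul, ← pow_succ'] at this
          convert this using 1
          push_cast
          ring
      have := iter m
      rw [hgm, one_smul, sub_self, zero_sub, neg_mem_iff] at this
      exact (Ideal.IsPrime.mul_mem_pow P this).resolve_left hm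
  have hbot : g • x - x ∈ ⨅ i : ℕ, P ^ i := by
    refine (Ideal.mem_iInf).2 fun i ↦ Ideal.pow_le_pow_right (Nat.le_succ i) (main i x)
  rw [Ideal.iInf_pow_eq_bot_of_isDomain P hP.ne_top] at hbot
  exact sub_eq_zero.1 hbot

/-- In residue characteristic two, inertial involutions act trivially on `P / P ^ 2`. -/
lemma smul_sub_mem_sq_of_involution [IsDedekindDomain R] {P : Ideal R} [hP : P.IsPrime]
    (hP0 : P ≠ ⊥) {g : G} (hg : g ∈ P.inertia G) (hgg : g * g = 1) (h2 : (2 : R) ∈ P)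
    (x : R) (hx : x ∈ P) : g • x - x ∈ P ^ 2 := by
  by_contra hy
  have hyP : g • x - x ∈ P := hg x
  obtain ⟨d, e, he, hde⟩ := Ideal.exists_mul_add_mem_pow_succ hP0 (i := 1) (g • x - x) x
    (by simpa using hyP) (by simpa using hy) (by simpa using hx)
  have hgy : g • (g • x - x) = -(g • x - x) := by
    rw [smul_sub, smul_smul, hgg, one_smul, neg_sub]
  have hge : g • e ∈ P ^ 2 := by
    have h := Ideal.inertia_le_stabilizer P hg
    rw [MulAction.mem_stabilizer_iff] at h
    have := Ideal.smul_mem_pointwise_smul g e _ he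
    rwa [Ideal.pointwise_smul_def, Ideal.map_pow, ← Ideal.pointwise_smul_def, h] at this
  apply hy
  have key : g • x - x = -((g • x - x) * (g • d - d)) - 2 * ((g • x - x) * d) + (g • e - e) := by
    conv_lhs => rw [← hde, smul_add, smul_mul', hgy]
    ring
  rw [key]
  refine Ideal.add_mem _ (Ideal.sub_mem _ ((Ideal.neg_mem_iff _).2 ?_) ?_) (Ideal.sub_mem _ hge he)
  · rw [pow_two]; exact Ideal.mul_mem_mul hyP (hg d)
  · rw [pow_two]; exact Ideal.mul_mem_mul h2 (Ideal.mul_mem_right _ _ hyP)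

/-- Two distinct involutions with product of order three cannot both lie in the inertia group of
a prime of residue characteristic two. -/
lemma two_notMem_of_involutions_mem_inertia [IsDedekindDomain R] [FaithfulSMul G R]
    {P : Ideal R} [hP : P.IsPrime] (hP0 : P ≠ ⊥) {s t : G} (hs : s ∈ P.inertia G)
    (ht : t ∈ P.inertia G) (hss : s * s = 1) (htt : t * t = 1) (hst : s ≠ t)
    (hst3 : (s * t) ^ 3 = 1) : (2 : R) ∉ P := by
  intro h2
  have h3 : ((3 : ℕ) : R) ∉ P := fun h3 ↦ hP.ne_top <| P.eq_top_iff_one.2 <| by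
    have := P.sub_mem h3 h2
    norm_num at this
    exact this
  have hP2 (x : R) (hx : x ∈ P) : (s * t) • x - x ∈ P ^ 2 := by
    have htx : t • x ∈ P := by
      have := P.add_mem (ht x) hx
      rwa [sub_add_cancel] at this
    have := Ideal.add_mem _ (smul_sub_mem_sq_of_involution hP0 hs hss h2 _ htx)
      (smul_sub_mem_sq_of_involution hP0 ht htt h2 x hx)
    rwa [sub_add_sub_cancel, smul_smul] at this
  have h1 : s * t = 1 := FaithfulSMul.eq_of_smul_eq_smul (α := R) fun x ↦ by
    rw [smul_eq_self_of_mem_inertia (mul_mem hs ht) hP2 hst3 h3, one_smul]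
  exact hst (by rw [eq_inv_of_mul_eq_one_left h1, inv_eq_of_mul_eq_one_left htt])

lemma mem_inertia_smul_iff (P : Ideal R) (g h : G) :
    h ∈ (g • P).inertia G ↔ g⁻¹ * h * g ∈ P.inertia G := by
  have (x : R) : h • x - x ∈ g • P ↔ (g⁻¹ * h * g) • (g⁻¹ • x) - g⁻¹ • x ∈ P := by
    rw [Ideal.mem_pointwise_smul_iff_inv_smul_mem, smul_sub]
    simp [smul_smul, mul_assoc]
  refine ⟨fun H x ↦ ?_, fun H x ↦ (this x).2 (H _)⟩
  simpa using (this (g • x)).1 (H _)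

lemma emultiplicity_smul_smul (g : G) (P I : Ideal R) :
    emultiplicity (g • P) (g • I) = emultiplicity P I :=
  emultiplicity_map_eq (MulDistribMulAction.toMulEquiv (Ideal R) g)

lemma absNorm_smul [IsDedekindDomain R] [Module.Free ℤ R] (g : G) (I : Ideal R) :
    Ideal.absNorm (g • I) = Ideal.absNorm I := by
  rw [Ideal.absNorm_apply, Ideal.absNorm_apply]
  exact (Nat.card_congr
    (Ideal.quotientEquiv I (g • I) (MulSemiringAction.toRingEquiv G R g) rfl).toEquiv).symm

lemma smul_map_eq {A : Type*} [CommRing A] [Algebra A R] {g : G}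
    (hg : ∀ a : A, g • algebraMap A R a = algebraMap A R a) (I : Ideal A) :
    g • I.map (algebraMap A R) = I.map (algebraMap A R) := by
  rw [Ideal.pointwise_smul_def, Ideal.map_map]
  congr 1
  ext a
  exact hg a

end Inertia

section Different

variable (F : Type*) {E : Type*} [Field F] [Field E] [NumberField F] [NumberField E] [Algebra F E]

lemma emultiplicity_map_eq_ramificationIdx_mul (Q : Ideal (𝓞 E)) [Q.IsPrime] (hQ : Q ≠ ⊥)
    {I : Ideal (𝓞 F)} (hI : I ≠ ⊥) :
    emultiplicity Q (I.map (algebraMap (𝓞 F) (𝓞 E))) =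
      Q.ramificationIdx (𝓞 F) * emultiplicity (Q.under (𝓞 F)) I := by
  have hq : Q.under (𝓞 F) ≠ ⊥ := Ideal.under_ne_bot _ hQ
  rw [Ideal.IsDedekindDomain.emultiplicity_map_eq_ramificationIdx'_mul hI
    ((Ideal.prime_iff_isPrime hq).2 inferInstance).irreducible
    ((Ideal.prime_iff_isPrime hQ).2 inferInstance).irreducible hQ,
    Ideal.ramificationIdx'_eq_ramificationIdx _ _ hq]

lemma emultiplicity_differentIdeal_eq_zero (Q : Ideal (𝓞 E)) [Q.IsPrime]
    (h : Q.ramificationIdx (𝓞 F) = 1) : emultiplicity Q (differentIdeal (𝓞 F) (𝓞 E)) = 0 := by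
  rw [emultiplicity_eq_zero, not_dvd_differentIdeal_iff, ← Ideal.ramificationIdx_eq_one_iff, h]

/-- The different exponent of a tamely ramified prime in a quadratic extension is one. -/
lemma emultiplicity_differentIdeal_eq_one (hFE : Module.finrank F E = 2) (Q : Ideal (𝓞 E))
    [Q.IsPrime] (hQ : Q ≠ ⊥) (h : Q.ramificationIdx (𝓞 F) = 2) (h2 : (2 : 𝓞 E) ∉ Q) :
    emultiplicity Q (differentIdeal (𝓞 F) (𝓞 E)) = 1 := by
  set p := Q.under (𝓞 F) with hp
  have hq : p ≠ ⊥ := Ideal.under_ne_bot _ hQ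
  have hmax : p.IsMaximal := Ring.DimensionLEOne.maximalOfPrime hq inferInstance
  have hpp : Prime p := (Ideal.prime_iff_isPrime hq).2 inferInstance
  have hmul : emultiplicity Q (p.map (algebraMap (𝓞 F) (𝓞 E))) = 2 := by
    rw [emultiplicity_map_eq_ramificationIdx_mul F Q hQ hq, h,
      (FiniteMultiplicity.of_prime_left hpp hq).emultiplicity_self]
    simp
  have hdvd : Q ^ 2 ∣ p.map (algebraMap (𝓞 F) (𝓞 E)) :=
    pow_dvd_of_le_emultiplicity (by rw [hmul]; rfl)
  have hfr : Module.finrank (𝓞 F) (𝓞 E) = 2 := by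
    rw [← IsFractionRing.finrank_eq (𝓞 F) F (𝓞 E) E, hFE]
  have hmap : Q ^ 2 * ⊤ = p.map (algebraMap (𝓞 F) (𝓞 E)) := by
    obtain ⟨I, hI⟩ := hdvd
    have h1 := congrArg Ideal.absNorm hI
    rw [Ideal.absNorm_algebraMap, map_mul, map_pow, hfr,
      ← Ideal.absNorm_pow_inertiaDeg p Q, pow_right_comm] at h1
    have hp2 : 2 ≤ Ideal.absNorm p := by
      have h0 : Ideal.absNorm p ≠ 0 := by simpa [Ideal.absNorm_eq_zero_iff] using hq
      have h1 : Ideal.absNorm p ≠ 1 := by simpa [Ideal.absNorm_eq_one_iff] using hmax.ne_top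
      lia
    have hf : Ideal.absNorm p ^ 2 ∣ (Ideal.absNorm p ^ 2) ^ Q.inertiaDeg (𝓞 F) :=
      dvd_pow_self _ (Q.inertiaDeg_pos (𝓞 F)).ne'
    have hN : Ideal.absNorm I = 1 := by
      obtain ⟨c, hc⟩ := hf
      rw [hc, mul_assoc] at h1
      exact (mul_eq_one.1 (Nat.eq_of_mul_eq_mul_left (by positivity)
        (h1.symm.trans (mul_one _).symm))).2
    rw [hI, Ideal.absNorm_eq_one_iff.1 hN]
  have h1 : Q ∣ differentIdeal (𝓞 F) (𝓞 E) := by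
    simpa using pow_sub_one_dvd_differentIdeal (𝓞 F) Q 2 hq hdvd
  have h2' : ¬ Q ^ 2 ∣ differentIdeal (𝓞 F) (𝓞 E) := by
    refine not_dvd_differentIdeal_of_intTrace_not_mem (𝓞 F) (Q ^ 2) ⊤ hmap 1 trivial ?_
    have htr : Algebra.intTrace (𝓞 F) (𝓞 E) 1 = 2 := by
      apply IsFractionRing.injective (𝓞 F) F
      rw [Algebra.algebraMap_intTrace (L := E), map_one, ← map_one (algebraMap F E),
        Algebra.trace_algebraMap, hFE, map_ofNat]
      simp
    rwa [htr, hp, Ideal.mem_comap, map_ofNat]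
  exact (emultiplicity_eq_coe (n := 1)).2 ⟨by simpa using h1, h2'⟩

end Different

section Galois

variable {K L : Type*} [Field K] [Field L] [NumberField K] [NumberField L] [Algebra K L]
  [IsGalois K L]

lemma ramificationIdx_eq_card_inertia (Q : Ideal (𝓞 L)) [Q.IsPrime] :
    Q.ramificationIdx (𝓞 K) = Nat.card (Q.inertia (L ≃ₐ[K] L)) := by
  rw [← Ideal.ramificationIdxIn_eq_ramificationIdx (Q.under (𝓞 K)) Q (L ≃ₐ[K] L),
    Ideal.card_inertia_eq_ramificationIdxIn (Q.under (𝓞 K))]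

/-- The ramification index over an intermediate field `F` is the order of the intersection of the
inertia group with the fixing subgroup of `F`. -/
lemma ramificationIdx_eq_card_inertia_inf (F : IntermediateField K L) (Q : Ideal (𝓞 L))
    [Q.IsPrime] :
    Q.ramificationIdx (𝓞 F) = Nat.card ↥(Q.inertia (L ≃ₐ[K] L) ⊓ F.fixingSubgroup) := by
  have : IsGaloisGroup F.fixingSubgroup F L := IsGaloisGroup.intermediateField ..
  have : IsGaloisGroup F.fixingSubgroup (𝓞 F) (𝓞 L) :=
    IsGaloisGroup.of_isFractionRing F.fixingSubgroup (𝓞 F) (𝓞 L) F L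
  rw [← Ideal.ramificationIdxIn_eq_ramificationIdx (Q.under (𝓞 F)) Q F.fixingSubgroup,
    ← Ideal.card_inertia_eq_ramificationIdxIn (G := F.fixingSubgroup) (Q.under (𝓞 F)) Q,
    ← Subgroup.subgroupOf_map_subtype]
  exact Nat.card_congr (Subgroup.equivMapOfInjective _ _ (Subgroup.subtype_injective _)).toEquiv

lemma card_inertia_eq_ramificationIdx_mul (Q : Ideal (𝓞 L)) [Q.IsPrime]
    (F : IntermediateField K L) :
    Nat.card (Q.inertia (L ≃ₐ[K] L)) = (Q.under (𝓞 F)).ramificationIdx (𝓞 K) *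
      Nat.card ↥(Q.inertia (L ≃ₐ[K] L) ⊓ F.fixingSubgroup) := by
  rw [← ramificationIdx_eq_card_inertia Q, ← ramificationIdx_eq_card_inertia_inf F Q,
    Ideal.ramificationIdx_tower (Q.under (𝓞 F)) Q]

lemma emultiplicity_differentIdeal_eq_zero_of_inf_eq_bot (Q : Ideal (𝓞 L)) [Q.IsPrime]
    (F : IntermediateField K L)
    (h : Q.inertia (L ≃ₐ[K] L) ⊓ F.fixingSubgroup = ⊥) :
    emultiplicity Q (differentIdeal (𝓞 F) (𝓞 L)) = 0 :=
  emultiplicity_differentIdeal_eq_zero F Q <| by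
    rw [ramificationIdx_eq_card_inertia_inf F Q, h, Subgroup.card_bot]

lemma emultiplicity_map_differentIdeal_eq_zero_of_le (Q : Ideal (𝓞 L)) [Q.IsPrime]
    (hQ : Q ≠ ⊥) (F : IntermediateField K L)
    (h : Q.inertia (L ≃ₐ[K] L) ≤ F.fixingSubgroup) :
    emultiplicity Q ((differentIdeal (𝓞 K) (𝓞 F)).map (algebraMap (𝓞 F) (𝓞 L))) = 0 := by
  have he := card_inertia_eq_ramificationIdx_mul Q F
  rw [inf_eq_left.2 h, right_eq_mul₀ Nat.card_pos.ne'] at he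
  rw [emultiplicity_map_eq_ramificationIdx_mul F Q hQ differentIdeal_ne_bot,
    emultiplicity_differentIdeal_eq_zero K _ he, mul_zero]

/-- If `L / F'` and `F / K` are both unramified at `Q`, then the different exponents of `L / F` and
`F' / K` at `Q` agree. -/
lemma emultiplicity_differentIdeal_eq_of_le_of_inf_eq_bot (Q : Ideal (𝓞 L)) [Q.IsPrime]
    (hQ : Q ≠ ⊥) (F F' : IntermediateField K L)
    (hF : Q.inertia (L ≃ₐ[K] L) ≤ F.fixingSubgroup)
    (hF' : Q.inertia (L ≃ₐ[K] L) ⊓ F'.fixingSubgroup = ⊥) :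
    emultiplicity Q (differentIdeal (𝓞 F) (𝓞 L)) =
      emultiplicity Q ((differentIdeal (𝓞 K) (𝓞 F')).map (algebraMap (𝓞 F') (𝓞 L))) := by
  have hp : Prime Q := (Ideal.prime_iff_isPrime hQ).2 inferInstance
  have h := congrArg (emultiplicity Q)
    ((differentIdeal_eq_differentIdeal_mul_differentIdeal (𝓞 K) (𝓞 F) (𝓞 L)).symm.trans
    (differentIdeal_eq_differentIdeal_mul_differentIdeal (𝓞 K) (𝓞 F') (𝓞 L)))
  rwa [emultiplicity_mul hp, emultiplicity_mul hp,
    emultiplicity_map_differentIdeal_eq_zero_of_le Q hQ F hF,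
    emultiplicity_differentIdeal_eq_zero_of_inf_eq_bot Q F' hF', add_zero, zero_add] at h

lemma emultiplicity_differentIdeal_eq_one_of_inertia_eq_top (Q : Ideal (𝓞 L)) [Q.IsPrime]
    (hQ : Q ≠ ⊥) (hI : Q.inertia (L ≃ₐ[K] L) = ⊤) (h2 : (2 : 𝓞 L) ∉ Q) (F : IntermediateField K L)
    (hF : Module.finrank F L = 2) :
    emultiplicity Q (differentIdeal (𝓞 F) (𝓞 L)) = 1 :=
  emultiplicity_differentIdeal_eq_one F hF Q hQ
    (by rw [ramificationIdx_eq_card_inertia_inf F Q, hI, top_inf_eq,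
      IsGalois.card_fixingSubgroup_eq_finrank, hF]) h2

lemma emultiplicity_map_differentIdeal_of_inertia_eq_top (Q : Ideal (𝓞 L)) [Q.IsPrime]
    (hQ : Q ≠ ⊥) (hI : Q.inertia (L ≃ₐ[K] L) = ⊤) (h2 : (2 : 𝓞 L) ∉ Q) (F : IntermediateField K L)
    (hF : Module.finrank K F = 2) :
    emultiplicity Q ((differentIdeal (𝓞 K) (𝓞 F)).map (algebraMap (𝓞 F) (𝓞 L))) =
      Module.finrank F L := by
  have he := card_inertia_eq_ramificationIdx_mul Q F
  have hcard := IsGalois.card_fixingSubgroup_eq_finrank F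
  rw [hI, top_inf_eq, Subgroup.card_top, hcard, IsGalois.card_aut_eq_finrank,
    ← Module.finrank_mul_finrank K F L, hF, Nat.mul_left_inj Module.finrank_pos.ne'] at he
  rw [emultiplicity_map_eq_ramificationIdx_mul F Q hQ differentIdeal_ne_bot,
    ramificationIdx_eq_card_inertia_inf F Q, hI, top_inf_eq, hcard,
    emultiplicity_differentIdeal_eq_one K hF _ (Ideal.under_ne_bot _ hQ) he.symm, mul_one]
  rwa [Ideal.mem_comap, map_ofNat]

end Galois

section SymmetricGroup

variable {G : Type*} [Group G]

lemma mem_of_pow_three_eq_one_of_index_two {H : Subgroup G} (hH : H.index = 2) {x : G}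
    (hx : x ^ 3 = 1) : x ∈ H := by
  have h := H.one_mem
  rw [← hx, pow_succ, Subgroup.mul_mem_iff_of_index_two hH] at h
  exact h.1 (Subgroup.sq_mem_of_index_two hH x)

lemma mul_self_eq_one_or_pow_three_eq_one (e : G ≃* Equiv.Perm (Fin 3)) (x : G) :
    x * x = 1 ∨ x ^ 3 = 1 := by
  have : ∀ x : Equiv.Perm (Fin 3), x * x = 1 ∨ x ^ 3 = 1 := by decide
  simpa [← map_mul, ← map_pow] using this (e x)

lemma pow_three_mul_eq_one_of_involutions (e : G ≃* Equiv.Perm (Fin 3)) {s t : G}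
    (hs : s * s = 1) (hs1 : s ≠ 1) (ht : t * t = 1) (ht1 : t ≠ 1) : (s * t) ^ 3 = 1 := by
  have : ∀ s t : Equiv.Perm (Fin 3), s * s = 1 → s ≠ 1 → t * t = 1 → t ≠ 1 →
    (s * t) ^ 3 = 1 := by decide
  simpa [← map_mul, ← map_pow, hs, hs1, ht, ht1] using this (e s) (e t)

/-- Each involution of `S₃` is conjugate to each other one by exactly two elements. -/
lemma card_filter_conj_eq [Fintype G] [DecidableEq G] (e : G ≃* Equiv.Perm (Fin 3))
    {x s : G} (hx : x * x = 1) (hx1 : x ≠ 1) (hs : s * s = 1) (hs1 : s ≠ 1) :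
    (Finset.univ.filter fun g : G ↦ g * x * g⁻¹ = s).card = 2 := by
  have key : ∀ x s : Equiv.Perm (Fin 3), x * x = 1 → x ≠ 1 → s * s = 1 → s ≠ 1 →
    (Finset.univ.filter fun g ↦ g * x * g⁻¹ = s).card = 2 := by decide
  rw [← key (e x) (e s) (by simp [← map_mul, hx]) (by simpa) (by simp [← map_mul, hs]) (by simpa)]
  exact Finset.card_equiv e.toEquiv fun g ↦ by simp [← map_mul, ← map_inv]

lemma mul_self_eq_one_of_notMem (e : G ≃* Equiv.Perm (Fin 3)) {H : Subgroup G}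
    (hH : H.index = 2) {x : G} (hx : x ∉ H) : x * x = 1 :=
  (mul_self_eq_one_or_pow_three_eq_one e x).resolve_right
    fun h ↦ hx (mem_of_pow_three_eq_one_of_index_two hH h)

/-- A prime which is totally ramified in a Galois extension with group `S₃` does not lie above 2. -/
lemma two_notMem_of_inertia_eq_top (e : G ≃* Equiv.Perm (Fin 3)) {H : Subgroup G}
    (hH : H.index = 2) {R : Type*} [CommRing R] [IsDedekindDomain R]
    [MulSemiringAction G R] [FaithfulSMul G R] {P : Ideal R} [P.IsPrime] (hP : P ≠ ⊥)
    (hI : P.inertia G = ⊤) (hH1 : H ≠ ⊥) : (2 : R) ∉ P := by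
  obtain ⟨x, hx⟩ : ∃ x, x ∉ H := by
    by_contra! h
    rw [(Subgroup.eq_top_iff' H).2 h, Subgroup.index_top] at hH
    lia
  obtain ⟨c, hc, hc1⟩ := H.bot_or_exists_ne_one.resolve_left hH1
  have hcx : c * x ∉ H := by simp [Subgroup.mul_mem_iff_of_index_two hH, hc, hx]
  have ne_one {y : G} (hy : y ∉ H) : y ≠ 1 := fun h ↦ hy (h ▸ H.one_mem)
  have hxx := mul_self_eq_one_of_notMem e hH hx
  have hcxx := mul_self_eq_one_of_notMem e hH hcx
  exact two_notMem_of_involutions_mem_inertia (G := G) hP (hI ▸ Subgroup.mem_top x)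
    (hI ▸ Subgroup.mem_top (c * x)) hxx hcxx (by simpa using hc1)
    (pow_three_mul_eq_one_of_involutions e hxx (ne_one hx) hcxx (ne_one hcx))

end SymmetricGroup

section LocalSum

variable {K L : Type*} [Field K] [Field L] [NumberField K] [NumberField L] [Algebra K L]
  [IsGalois K L]

/-- The exponents of the different of `L / L₃` at the conjugates of `P` sum up to twice the exponent
at `P` of the different of `L₂ / K`. -/
lemma sum_emultiplicity_differentIdeal (e : (L ≃ₐ[K] L) ≃* Equiv.Perm (Fin 3))
    (L₃ L₂ : IntermediateField K L) (h3 : Module.finrank K L₃ = 3)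
    (h2 : Module.finrank K L₂ = 2) (P : Ideal (𝓞 L)) [P.IsPrime] (hP : P ≠ ⊥) :
    ∑ g : L ≃ₐ[K] L, emultiplicity (g • P) (differentIdeal (𝓞 L₃) (𝓞 L)) =
      2 * emultiplicity P
        ((differentIdeal (𝓞 K) (𝓞 L₂)).map (algebraMap (𝓞 L₂) (𝓞 L))) := by
  classical
  set J := (differentIdeal (𝓞 K) (𝓞 L₂)).map (algebraMap (𝓞 L₂) (𝓞 L)) with hJ
  set I := P.inertia (L ≃ₐ[K] L) with hI
  set H := L₂.fixingSubgroup with hH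
  have hG : Nat.card (L ≃ₐ[K] L) = 6 := by
    rw [Nat.card_congr e.toEquiv]
    simp [Fintype.card_perm, Nat.factorial]
  have hKL : Module.finrank K L = 6 := by rw [← IsGalois.card_aut_eq_finrank, hG]
  have hf3 : Module.finrank L₃ L = 2 := by
    have := Module.finrank_mul_finrank K L₃ L
    lia
  have hf2 : Module.finrank L₂ L = 3 := by
    have := Module.finrank_mul_finrank K L₂ L
    lia
  have hcard3 : Nat.card L₃.fixingSubgroup = 2 := by
    rw [IsGalois.card_fixingSubgroup_eq_finrank, hf3]
  have hcard2 : Nat.card H = 3 := by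
    rw [IsGalois.card_fixingSubgroup_eq_finrank, hf2]
  have hindex : H.index = 2 := by
    have := H.card_mul_index
    lia
  have hnormal : H.Normal := Subgroup.normal_of_index_eq_two hindex
  have hH1 : H ≠ ⊥ := by
    intro h
    rw [h, Subgroup.card_bot] at hcard2
    lia
  have hpow {x : L ≃ₐ[K] L} (hx : x ∈ H) : x ^ 3 = 1 := by
    rw [← hcard2]
    exact congrArg Subtype.val (pow_card_eq_one' (x := (⟨x, hx⟩ : H)))
  have hinv {x : L ≃ₐ[K] L} (hx : x ∈ H) (hxx : x * x = 1) : x = 1 := by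
    have := hpow hx
    rwa [pow_succ, pow_two, hxx, one_mul] at this
  obtain ⟨⟨s, hs⟩, hs1, hsu⟩ := (Nat.card_eq_two_iff' 1).1 hcard3
  have hs1' : s ≠ 1 := fun h ↦ hs1 (Subtype.ext h)
  have hmem3 {y : L ≃ₐ[K] L} (hy : y ∈ L₃.fixingSubgroup) : y = 1 ∨ y = s := by
    by_cases h : y = 1
    · exact .inl h
    · exact .inr (congrArg Subtype.val (hsu ⟨y, hy⟩ fun h' ↦ h (congrArg Subtype.val h')))
  have hss : s * s = 1 := (hmem3 (mul_mem hs hs)).resolve_right fun h ↦ hs1' (by simpa using h)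
  have hsH : s ∉ H := fun h ↦ hs1' (hinv h hss)
  have hgP (g : L ≃ₐ[K] L) : g • P ≠ ⊥ := by
    rw [← Ideal.zero_eq_bot, Ne, smul_eq_zero_iff_eq]
    exact hP
  have hzero {g : L ≃ₐ[K] L} (hg : g⁻¹ * s * g ∉ I) :
      emultiplicity (g • P) (differentIdeal (𝓞 L₃) (𝓞 L)) = 0 := by
    refine emultiplicity_differentIdeal_eq_zero_of_inf_eq_bot (g • P) L₃ ?_
    refine (Subgroup.eq_bot_iff_forall _).2 fun y ⟨hy, hy3⟩ ↦ (hmem3 hy3).resolve_right ?_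
    rintro rfl
    exact hg ((mem_inertia_smul_iff P g y).1 hy)
  by_cases hIH : I ≤ H
  · rw [emultiplicity_map_differentIdeal_eq_zero_of_le P hP L₂ hIH, mul_zero]
    refine Finset.sum_eq_zero fun g _ ↦ hzero fun hg ↦ hsH ?_
    simpa [mul_assoc] using hnormal.conj_mem _ (hIH hg) g
  obtain ⟨x, hx, hxH⟩ := SetLike.not_le_iff_exists.1 hIH
  have hxx : x * x = 1 := mul_self_eq_one_of_notMem e hindex hxH
  have hx1 : x ≠ 1 := fun h ↦ hxH (h ▸ H.one_mem)
  by_cases hIx : ∀ y ∈ I, y = 1 ∨ y = x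
  · have hterm (g : L ≃ₐ[K] L) : emultiplicity (g • P) (differentIdeal (𝓞 L₃) (𝓞 L)) =
        if g * x * g⁻¹ = s then emultiplicity P J else 0 := by
      split_ifs with hg
      · have hconj {y : L ≃ₐ[K] L} (hy : y ∈ (g • P).inertia (L ≃ₐ[K] L)) : y = 1 ∨ y = s := by
          rw [mem_inertia_smul_iff] at hy
          refine (hIx _ hy).imp (fun h ↦ ?_) (fun h ↦ ?_)
          · simpa [mul_assoc, inv_mul_eq_iff_eq_mul] using h
          · rw [← hg, ← h]; group
        rw [emultiplicity_differentIdeal_eq_of_le_of_inf_eq_bot _ (hgP g) L₃ L₂, ← hJ]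
        · have hfix {c : L ≃ₐ[K] L} (hc : c ∈ H) : c • J = J := by
            refine smul_map_eq (fun a ↦ ?_) _
            exact RingOfIntegers.ext
              ((mem_fixingSubgroup_iff _).1 hc _ (SetLike.coe_mem (a : L₂)))
          by_cases hgH : g ∈ H
          · rw [← emultiplicity_smul_smul g P J, hfix hgH]
          · have hgx : g * x ∈ H := by
              rw [Subgroup.mul_mem_iff_of_index_two hindex]
              exact iff_of_false hgH hxH
            have hxP : x • P = P := Ideal.inertia_le_stabilizer P hx
            rw [← emultiplicity_smul_smul (g * x) P J, hfix hgx, mul_smul, hxP]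
        · intro y hy
          obtain rfl | rfl := hconj hy
          · exact one_mem _
          · exact hs
        · refine (Subgroup.eq_bot_iff_forall _).2 fun y ⟨hy, hyH⟩ ↦ (hconj hy).resolve_right ?_
          rintro rfl
          exact hsH hyH
      · refine hzero fun h ↦ hg ?_
        obtain h | h := hIx _ h
        · refine absurd ?_ hs1'
          simpa [mul_assoc, inv_mul_eq_iff_eq_mul] using h
        · rw [← h]; group
    simp_rw [hterm, Finset.sum_ite, Finset.sum_const_zero, add_zero, Finset.sum_const,
      card_filter_conj_eq e hxx hx1 hss hs1']
    simp
  push Not at hIx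
  obtain ⟨y, hy, hy1, hyx⟩ := hIx
  have hHI : H ≤ I := by
    have : Fact (Nat.card H).Prime := ⟨hcard2 ▸ Nat.prime_three⟩
    have hIH' : I.subgroupOf H ≠ ⊥ := by
      rw [Ne, Subgroup.subgroupOf_eq_bot]
      intro hdis
      rw [Subgroup.disjoint_def] at hdis
      by_cases hyH : y ∈ H
      · exact hy1 (hdis hy hyH)
      · refine hyx ?_
        have := hdis (mul_mem hy hx)
          ((Subgroup.mul_mem_iff_of_index_two hindex).2 (iff_of_false hyH hxH))
        rw [eq_inv_of_mul_eq_one_left this, inv_eq_of_mul_eq_one_left hxx]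
    exact Subgroup.subgroupOf_eq_top.1
      ((I.subgroupOf H).eq_bot_or_eq_top_of_prime_card.resolve_left hIH')
  have hItop : I = ⊤ := by
    refine (Subgroup.eq_top_iff' I).2 fun g ↦ ?_
    by_cases hg : g ∈ H
    · exact hHI hg
    · have := mul_mem (hHI ((Subgroup.mul_mem_iff_of_index_two hindex).2 (iff_of_false hg hxH))) hx
      rwa [mul_assoc, hxx, mul_one] at this
  have : FaithfulSMul (L ≃ₐ[K] L) (𝓞 L) := IsGaloisGroup.faithful (𝓞 K)
  have hone (g : L ≃ₐ[K] L) : emultiplicity (g • P) (differentIdeal (𝓞 L₃) (𝓞 L)) = 1 := by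
    have htop : (g • P).inertia (L ≃ₐ[K] L) = ⊤ :=
      (Subgroup.eq_top_iff' _).2 fun h ↦ by
        rw [mem_inertia_smul_iff, ← hI, hItop]
        trivial
    exact emultiplicity_differentIdeal_eq_one_of_inertia_eq_top _ (hgP g) htop
      (two_notMem_of_inertia_eq_top e hindex (hgP g) htop hH1) L₃ hf3
  rw [emultiplicity_map_differentIdeal_of_inertia_eq_top P hP hItop
    (two_notMem_of_inertia_eq_top e hindex hP hItop hH1) L₂ h2, hf2]
  simp_rw [hone, Finset.sum_const, Finset.card_univ, ← Nat.card_eq_fintype_card, hG]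
  norm_num

end LocalSum

/-- For an `S₃` Galois extension `L/K` of number fields with a cubic subextension `L₃` and
the quadratic subextension `L₂`, one has `D_L · D_K² = D_{L₃}² · D_{L₂}`. -/
theorem discr_S3 (K L : Type) [Field K] [Field L] [NumberField K] [NumberField L]
    [Algebra K L] [IsGalois K L]
    (hgal : Nonempty ((L ≃ₐ[K] L) ≃* Equiv.Perm (Fin 3)))
    (L₃ L₂ : IntermediateField K L)
    [NumberField ↥L₃] [NumberField ↥L₂]
    (hr3 : Module.finrank K ↥L₃ = 3) (hr2 : Module.finrank K ↥L₂ = 2) :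
    (NumberField.discr L).natAbs * (NumberField.discr K).natAbs ^ 2
      = (NumberField.discr ↥L₃).natAbs ^ 2 * (NumberField.discr ↥L₂).natAbs := by
  obtain ⟨e⟩ := hgal
  set D := differentIdeal (𝓞 L₃) (𝓞 L) with hD
  set J := differentIdeal (𝓞 K) (𝓞 L₂) with hJ
  set J' := J.map (algebraMap (𝓞 L₂) (𝓞 L)) with hJ'
  have hcard : Fintype.card (L ≃ₐ[K] L) = 6 := by
    rw [Fintype.card_congr e.toEquiv]
    simp [Fintype.card_perm, Nat.factorial]
  have hKL : Module.finrank K L = 6 := by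
    rw [← IsGalois.card_aut_eq_finrank, Nat.card_eq_fintype_card, hcard]
  have hf3 : Module.finrank L₃ L = 2 := by
    have := Module.finrank_mul_finrank K L₃ L
    lia
  have hf2 : Module.finrank L₂ L = 3 := by
    have := Module.finrank_mul_finrank K L₂ L
    lia
  have hJ0 : J' ≠ 0 := by
    rw [hJ', Ne, Ideal.zero_eq_bot, Ideal.map_eq_bot_iff_of_injective
      (FaithfulSMul.algebraMap_injective (𝓞 L₂) (𝓞 L))]
    exact differentIdeal_ne_bot
  have hprod : ∏ g : L ≃ₐ[K] L, g⁻¹ • D = J' ^ 2 := by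
    have hD0 : ∏ g : L ≃ₐ[K] L, g⁻¹ • D ≠ 0 := Finset.prod_ne_zero_iff.2 fun g _ ↦ by
      rw [Ne, smul_eq_zero_iff_eq]
      exact differentIdeal_ne_bot
    have hv (P : Ideal (𝓞 L)) (hP : Prime P) :
        emultiplicity P (∏ g : L ≃ₐ[K] L, g⁻¹ • D) = emultiplicity P (J' ^ 2) := by
      have := Ideal.isPrime_of_prime hP
      rw [Finset.emultiplicity_prod hP, emultiplicity_pow hP, Nat.cast_ofNat,
        ← sum_emultiplicity_differentIdeal e L₃ L₂ hr3 hr2 P hP.ne_zero]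
      refine Finset.sum_congr rfl fun g _ ↦ ?_
      rw [← emultiplicity_smul_smul g, smul_inv_smul]
    exact dvd_antisymm
      ((UniqueFactorizationMonoid.dvd_iff_emultiplicity_le hD0).2 fun P hP ↦ (hv P hP).le)
      ((UniqueFactorizationMonoid.dvd_iff_emultiplicity_le (pow_ne_zero 2 hJ0)).2
        fun P hP ↦ (hv P hP).ge)
  have hnorm : Ideal.absNorm D = Ideal.absNorm J := by
    have h := congrArg Ideal.absNorm hprod
    simp_rw [map_prod, absNorm_smul, Finset.prod_const, Finset.card_univ, hcard, map_pow, hJ',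
      Ideal.absNorm_algebraMap, ← IsFractionRing.finrank_eq (𝓞 L₂) L₂ (𝓞 L) L, hf2,
      ← pow_mul] at h
    exact Nat.pow_left_injective (n := 6) (by norm_num) h
  rw [natAbs_discr_eq_absNorm_differentIdeal_mul_natAbs_discr_pow L₃ (𝓞 L₃) L (𝓞 L),
    natAbs_discr_eq_absNorm_differentIdeal_mul_natAbs_discr_pow K (𝓞 K) L₂ (𝓞 L₂),
    ← hD, ← hJ, hnorm, hf3, hr2]
  ring
end

section
/- Let L_6 be a cyclic sextic number field with cubic subfield L_3 and quadratic subfield L_2. Then D_{L_6}/D_{L_3} = lcm(D_{L_2}^3, D_{L_2} · D_{L_3}). -/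
open Module NumberField nonZeroDivisors

section AbsNorm

variable {S : Type*} [CommRing S] [IsDedekindDomain S] [Module.Free ℤ S] [Module.Finite ℤ S]

/-- Comparing two ideals at all primes above `p` compares the `p`-adic valuations of their norms. -/
lemma Ideal.factorization_absNorm_le_of_emultiplicity_le {p : ℕ} (hp : p.Prime) {I J : Ideal S}
    (hI : I ≠ ⊥) (hJ : J ≠ ⊥)
    (h : ∀ P : Ideal S, P.IsMaximal → P.under ℤ = .span {(p : ℤ)} →
      emultiplicity P I ≤ emultiplicity P J) :
    (absNorm I).factorization p ≤ (absNorm J).factorization p := by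
  obtain ⟨G, hG⟩ : ∃ G, G = I ⊔ J := ⟨_, rfl⟩
  have hG0 : G ≠ ⊥ := fun h ↦ hI (le_bot_iff.mp (h ▸ hG ▸ le_sup_left))
  obtain ⟨I', hI'⟩ := Ideal.dvd_iff_le.mpr (hG ▸ le_sup_left : I ≤ G)
  obtain ⟨J', hJ'⟩ := Ideal.dvd_iff_le.mpr (hG ▸ le_sup_right : J ≤ G)
  have hN : ∀ {K : Ideal S}, K ≠ ⊥ → absNorm K ≠ 0 := fun h ↦ by rwa [Ne, absNorm_eq_zero_iff]
  have hI'0 : I' ≠ ⊥ := by rintro rfl; exact hI (by rw [hI', Ideal.mul_bot])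
  have hJ'0 : J' ≠ ⊥ := by rintro rfl; exact hJ (by rw [hJ', Ideal.mul_bot])
  have hpI' : ¬ p ∣ absNorm I' := by
    intro hdvd
    obtain ⟨P, hP, hPp, hPI'⟩ := exists_isMaximal_dvd_of_dvd_absNorm' hp I' hdvd
    have hPprime : Prime P :=
      Ideal.prime_of_isPrime (fun h ↦ hI'0 (zero_dvd_iff.mp (h ▸ hPI' :))) hP.isPrime
    by_cases hPJ' : P ∣ J'
    · have hGP : G * P ∣ G * 1 := by
        rw [mul_one, Ideal.dvd_iff_le]
        nth_rw 1 [hG]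
        refine sup_le (Ideal.dvd_iff_le.mp ?_) (Ideal.dvd_iff_le.mp ?_)
        · exact hI' ▸ mul_dvd_mul_left _ hPI'
        · exact hJ' ▸ mul_dvd_mul_left _ hPJ'
      exact hPprime.not_dvd_one ((mul_dvd_mul_iff_left hG0).mp hGP)
    · have hle := h P hP hPp
      rw [hI', hJ', emultiplicity_mul hPprime, emultiplicity_mul hPprime,
        emultiplicity_eq_zero.mpr hPJ',
        (FiniteMultiplicity.of_prime_left hPprime hG0).emultiplicity_eq_multiplicity] at hle
      have h1 : emultiplicity P I' = 0 := by
        simpa using (ENat.add_le_add_iff_left (ENat.natCast_ne_top _)).mp hle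
      exact emultiplicity_eq_zero.mp h1 hPI'
  rw [hI', hJ', map_mul, map_mul, Nat.factorization_mul (hN hG0) (hN hI'0),
    Nat.factorization_mul (hN hG0) (hN hJ'0)]
  simp [Nat.factorization_eq_zero_of_not_dvd hpI']

lemma Ideal.mul_factorization_absNorm_le {p : ℕ} (hp : p.Prime) {I J : Ideal S}
    (hI : I ≠ ⊥) (hJ : J ≠ ⊥) (a b : ℕ)
    (h : ∀ P : Ideal S, P.IsMaximal → P.under ℤ = .span {(p : ℤ)} →
      a * emultiplicity P I ≤ b * emultiplicity P J) :
    a * (absNorm I).factorization p ≤ b * (absNorm J).factorization p := by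
  have := factorization_absNorm_le_of_emultiplicity_le hp (pow_ne_zero a hI) (pow_ne_zero b hJ)
    fun P hP hPp ↦ by
      have hP0 : P ≠ ⊥ := by
        rintro rfl
        have : IsAddTorsionFree S := .of_isTorsionFree ℤ _
        have := CharZero.of_isAddTorsionFree S S
        simp [eq_comm (a := (⊥ : Ideal ℤ)), hp.ne_zero] at hPp
      have hPprime : Prime P := Ideal.prime_of_isPrime hP0 hP.isPrime
      rw [emultiplicity_pow hPprime, emultiplicity_pow hPprime]
      exact h P hP hPp
  simpa using this

end AbsNorm

section Different

variable {A B : Type*} [CommRing A] [IsDedekindDomain A] [CommRing B] [IsDedekindDomain B]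
  [Algebra A B] [Module.Free ℤ A] [Module.Finite ℤ A] [Module.Free ℤ B] [Module.Finite ℤ B]
  [Module.Finite A B] [IsTorsionFree A B]

lemma Ideal.map_eq_pow_of_ramificationIdx_eq_finrank {q : Ideal A} (hq : q ≠ ⊥)
    (P : Ideal B) [P.IsPrime] [P.LiesOver q] (h : P.ramificationIdx A = finrank A B) :
    q.map (algebraMap A B) = P ^ finrank A B := by
  have hq' : q.IsPrime := isPrime_of_liesOver P q
  have hdvd : P ^ finrank A B ∣ q.map (algebraMap A B) := by
    rw [Ideal.dvd_iff_le, ← h, ← ramificationIdx'_eq_ramificationIdx q P hq]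
    exact le_pow_ramificationIdx'
  obtain ⟨Q, hQ⟩ := hdvd
  have hN := congr_arg absNorm hQ
  have hq0 : absNorm q ≠ 0 := by rwa [Ne, absNorm_eq_zero_iff]
  rw [absNorm_algebraMap, map_mul, map_pow, ← absNorm_pow_inertiaDeg q P, ← pow_mul] at hN
  have hQ1 : absNorm Q = 1 := by
    obtain ⟨f, hf⟩ := Nat.exists_eq_add_of_lt (inertiaDeg_pos P A)
    rw [hf] at hN
    have : absNorm q ^ finrank A B * (absNorm q ^ (f * finrank A B) * absNorm Q) =
        absNorm q ^ finrank A B * 1 := by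
      rw [mul_one]
      refine Eq.trans ?_ hN.symm
      ring
    exact Nat.eq_one_of_mul_eq_one_left (Nat.eq_of_mul_eq_mul_left (by positivity) this)
  rw [hQ, absNorm_eq_one_iff.mp hQ1, Ideal.mul_top]

attribute [local instance] FractionRing.liftAlgebra

omit [Free ℤ B] [Module.Finite ℤ B] in
lemma isSeparable_fractionRing_of_free_int :
    Algebra.IsSeparable (FractionRing A) (FractionRing B) := by
  have : IsAddTorsionFree A := .of_isTorsionFree ℤ _
  have := CharZero.of_isAddTorsionFree A A
  have : FiniteDimensional (FractionRing A) (FractionRing B) := .of_isLocalization A B A⁰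
  infer_instance

omit [Free ℤ B] [Module.Finite ℤ B] in
lemma ramificationIdx_sub_one_le_emultiplicity_differentIdeal {q : Ideal A} (hq : q ≠ ⊥)
    (P : Ideal B) [P.IsPrime] [P.LiesOver q] :
    (P.ramificationIdx A - 1 : ℕ) ≤ emultiplicity P (differentIdeal A B) := by
  have := isSeparable_fractionRing_of_free_int (A := A) (B := B)
  have hqp : q.IsPrime := Ideal.isPrime_of_liesOver P q
  have := hqp.isMaximal hq
  refine le_emultiplicity_of_pow_dvd (pow_sub_one_dvd_differentIdeal A P _ hq ?_)
  rw [Ideal.dvd_iff_le, ← Ideal.ramificationIdx'_eq_ramificationIdx q P hq]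
  exact Ideal.le_pow_ramificationIdx'

omit [Free ℤ A] [Module.Finite ℤ A] [Free ℤ B] [Module.Finite ℤ B] in
lemma intTrace_one : Algebra.intTrace A B 1 = (finrank A B : A) := by
  apply FaithfulSMul.algebraMap_injective A (FractionRing A)
  rw [Algebra.algebraMap_intTrace_fractionRing, map_one, map_natCast,
    ← map_one (algebraMap (FractionRing A) (FractionRing B)), Algebra.trace_algebraMap,
    IsFractionRing.finrank_eq A (FractionRing A) B (FractionRing B), nsmul_one]

lemma emultiplicity_differentIdeal_of_ramificationIdx {q : Ideal A} (hq : q ≠ ⊥)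
    (P : Ideal B) [P.IsPrime] [P.LiesOver q] {n : ℕ} (hn : finrank A B = n)
    (h : P.ramificationIdx A = 1 ∨ P.ramificationIdx A = n ∧ (n : A) ∉ q) :
    emultiplicity P (differentIdeal A B) = (P.ramificationIdx A - 1 : ℕ) := by
  have := isSeparable_fractionRing_of_free_int (A := A) (B := B)
  rcases h with h | ⟨h, hnq⟩
  · rw [h, Nat.sub_self, Nat.cast_zero, emultiplicity_eq_zero, not_dvd_differentIdeal_iff]
    have : (P.under A).IsMaximal := by
      rw [← P.over_def q]; exact (Ideal.isPrime_of_liesOver P q).isMaximal hq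
    have : Finite (A ⧸ P.under A) :=
      Ideal.finiteQuotientOfFreeOfNeBot _ (P.over_def q ▸ hq)
    have : Finite (P.under A).ResidueField := .of_surjective _
      (Ideal.bijective_algebraMap_quotient_residueField (P.under A)).2
    exact Ideal.ramificationIdx_eq_one_iff.mp h
  · subst hn
    refine le_antisymm (Order.le_of_lt_add_one ?_)
      (ramificationIdx_sub_one_le_emultiplicity_differentIdeal hq P)
    have hcast : ((P.ramificationIdx A - 1 : ℕ) : ℕ∞) + 1 = P.ramificationIdx A := by
      exact_mod_cast Nat.sub_add_cancel (P.ramificationIdx_pos A)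
    rw [hcast, emultiplicity_lt_iff_not_dvd, h]
    refine not_dvd_differentIdeal_of_intTrace_not_mem A (p := q) _ ⊤ ?_ 1 trivial ?_
    · rw [Ideal.mul_top, Ideal.map_eq_pow_of_ramificationIdx_eq_finrank hq P h]
    · rwa [intTrace_one]

end Different

section NumberField

open Ideal

lemma ramificationIdx_dvd_card {A B : Type*} [CommRing A] [IsDomain A] [CommRing B] [IsDomain B]
    [Algebra A B] [Module.Finite A B] [Module.Flat A B] (G : Type*) [Group G] [Finite G]
    [MulSemiringAction G B] [IsGaloisGroup G A B] (P : Ideal B) [P.IsPrime] :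
    P.ramificationIdx A ∣ Nat.card G := by
  rw [← ramificationIdxIn_eq_ramificationIdx (P.under A) P G,
    ← ncard_primesOver_mul_ramificationIdxIn_mul_inertiaDegIn (P.under A) B G]
  exact dvd_mul_of_dvd_right (dvd_mul_right _ _) _

lemma ramificationIdx_dvd_finrank (K L : Type*) [Field K] [NumberField K] [Field L] [NumberField L]
    [Algebra K L] [IsGalois K L] (P : Ideal (𝓞 L)) [P.IsPrime] :
    P.ramificationIdx (𝓞 K) ∣ finrank K L := by
  rw [← IsGalois.card_aut_eq_finrank]
  exact ramificationIdx_dvd_card Gal(L/K) P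

lemma ramificationIdx_int_dvd_finrank (K : Type*) [Field K] [NumberField K] [IsGalois ℚ K]
    (P : Ideal (𝓞 K)) [P.IsPrime] : P.ramificationIdx ℤ ∣ finrank ℚ K := by
  rw [← IsGalois.card_aut_eq_finrank]
  exact ramificationIdx_dvd_card Gal(K/ℚ) P

variable {K K' L : Type*} [Field K] [NumberField K] [Field K'] [NumberField K'] [Field L]
  [NumberField L] [Algebra K L] [Algebra K' L]

lemma emultiplicity_map_ringOfIntegers {P : Ideal (𝓞 L)} (hP : P.IsMaximal) {I : Ideal (𝓞 K)}
    (hI : I ≠ ⊥) :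
    emultiplicity P (I.map (algebraMap (𝓞 K) (𝓞 L))) =
      P.ramificationIdx (𝓞 K) * emultiplicity (P.under (𝓞 K)) I := by
  have hP0 : P ≠ ⊥ := hP.ne_bot_of_isIntegral_int
  have hq : (P.under (𝓞 K)).IsMaximal := inferInstance
  have hq0 : P.under (𝓞 K) ≠ ⊥ := hq.ne_bot_of_isIntegral_int
  rw [← ramificationIdx'_eq_ramificationIdx (P.under (𝓞 K)) P hq0]
  exact IsDedekindDomain.emultiplicity_map_eq_ramificationIdx'_mul hI
    (prime_of_isPrime hq0 hq.isPrime).irreducible (prime_of_isPrime hP0 hP.isPrime).irreducible hP0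

variable [IsGalois ℚ K] [IsGalois ℚ K'] [IsGalois K L] [IsGalois K' L]

/-- In a compositum of Galois number fields of coprime degrees, ramification indices are unchanged
by base change. -/
lemma ramificationIdx_eq_ramificationIdx_under
    (hcop : (finrank ℚ K).Coprime (finrank ℚ K'))
    (hKL : finrank K L = finrank ℚ K') (hKL' : finrank K' L = finrank ℚ K)
    (P : Ideal (𝓞 L)) [P.IsPrime] :
    P.ramificationIdx (𝓞 K) = (P.under (𝓞 K')).ramificationIdx ℤ := by
  have h := ramificationIdx_tower (R := ℤ) (P.under (𝓞 K)) P
  rw [ramificationIdx_tower (R := ℤ) (P.under (𝓞 K')) P] at h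
  have h1 := ramificationIdx_int_dvd_finrank K (P.under (𝓞 K))
  have h2 := ramificationIdx_int_dvd_finrank K' (P.under (𝓞 K'))
  have h3 := hKL ▸ ramificationIdx_dvd_finrank K L P
  have h4 := hKL' ▸ ramificationIdx_dvd_finrank K' L P
  refine Nat.dvd_antisymm ?_ ?_
  · exact ((hcop.coprime_dvd_left h4).symm.coprime_dvd_left h3).dvd_of_dvd_mul_right
      (h ▸ dvd_mul_left _ _)
  · exact ((hcop.coprime_dvd_left h1).symm.coprime_dvd_left h2).dvd_of_dvd_mul_left
      (h ▸ dvd_mul_right _ _)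

lemma factorization_discr_of_ne {p : ℕ} (hp : p.Prime)
    (hl : (finrank ℚ K).Prime) (hl' : (finrank ℚ K').Prime) (hne : finrank ℚ K ≠ finrank ℚ K')
    (hKL : finrank K L = finrank ℚ K') (hKL' : finrank K' L = finrank ℚ K)
    (hpl : p ≠ finrank ℚ K') :
    ((discr K).natAbs.factorization p = 0 ∧ (discr L).natAbs.factorization p =
      finrank ℚ K * (discr K').natAbs.factorization p) ∨
    ((discr L).natAbs.factorization p =
      finrank ℚ K' * (discr K).natAbs.factorization p + (discr K').natAbs.factorization p ∧
      (finrank ℚ K - 1) * (discr K').natAbs.factorization p ≤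
        (finrank ℚ K' - 1) * (discr K).natAbs.factorization p) := by
  have hcop := (Nat.coprime_primes hl hl').mpr hne
  set e := (span {(p : ℤ)}).ramificationIdxIn (𝓞 K)
  set e' := (span {(p : ℤ)}).ramificationIdxIn (𝓞 K')
  have hdK : differentIdeal ℤ (𝓞 K) ≠ ⊥ := differentIdeal_ne_bot
  have hdK' : differentIdeal ℤ (𝓞 K') ≠ ⊥ := differentIdeal_ne_bot
  have hdL : differentIdeal (𝓞 K) (𝓞 L) ≠ ⊥ := differentIdeal_ne_bot
  have hmap : ((differentIdeal ℤ (𝓞 K)).map (algebraMap (𝓞 K) (𝓞 L))) ≠ ⊥ :=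
    map_ne_bot_of_ne_bot hdK
  have hmap' : ((differentIdeal ℤ (𝓞 K')).map (algebraMap (𝓞 K') (𝓞 L))) ≠ ⊥ :=
    map_ne_bot_of_ne_bot hdK'
  have hN : absNorm ((differentIdeal ℤ (𝓞 K)).map (algebraMap (𝓞 K) (𝓞 L))) =
      (discr K).natAbs ^ finrank ℚ K' := by
    rw [absNorm_algebraMap, absNorm_differentIdeal K, ← hKL,
      IsFractionRing.finrank_eq (𝓞 K) K (𝓞 L) L]
  have hN' : absNorm ((differentIdeal ℤ (𝓞 K')).map (algebraMap (𝓞 K') (𝓞 L))) =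
      (discr K').natAbs ^ finrank ℚ K := by
    rw [absNorm_algebraMap, absNorm_differentIdeal K', ← hKL',
      IsFractionRing.finrank_eq (𝓞 K') K' (𝓞 L) L]
  have hDL := natAbs_discr_eq_absNorm_differentIdeal_mul_natAbs_discr_pow K (𝓞 K) L (𝓞 L)
  have hlocal (P : Ideal (𝓞 L)) (hP : P.IsMaximal) (hPp : P.under ℤ = span {(p : ℤ)}) :
      emultiplicity P (differentIdeal (𝓞 K) (𝓞 L)) = (e' - 1 : ℕ) ∧
      emultiplicity P ((differentIdeal ℤ (𝓞 K')).map (algebraMap (𝓞 K') (𝓞 L))) =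
        e * (e' - 1 : ℕ) ∧
      e' * (e - 1 : ℕ) ≤
        emultiplicity P ((differentIdeal ℤ (𝓞 K)).map (algebraMap (𝓞 K) (𝓞 L))) ∧
      (e = 1 → emultiplicity P ((differentIdeal ℤ (𝓞 K)).map (algebraMap (𝓞 K) (𝓞 L))) = 0) ∧
      e ∣ finrank ℚ K ∧ e' ∣ finrank ℚ K' := by
    have hp0 : span {(p : ℤ)} ≠ ⊥ := by simpa using hp.ne_zero
    have hq : (P.under (𝓞 K)).IsMaximal := inferInstance
    have hq' : (P.under (𝓞 K')).IsMaximal := inferInstance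
    have : (P.under (𝓞 K)).LiesOver (span {(p : ℤ)}) := ⟨by rw [under_under, hPp]⟩
    have : (P.under (𝓞 K')).LiesOver (span {(p : ℤ)}) := ⟨by rw [under_under, hPp]⟩
    have hnmem : (finrank ℚ K' : ℤ) ∉ span {(p : ℤ)} := by
      rw [mem_span_singleton, Int.natCast_dvd_natCast, Nat.prime_dvd_prime_iff_eq hp hl']
      exact hpl
    have hnmem' : (finrank ℚ K' : 𝓞 K) ∉ P.under (𝓞 K) := by
      rwa [← hPp, mem_comap, map_natCast, ← map_natCast (algebraMap (𝓞 K) (𝓞 L)),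
        ← mem_comap] at hnmem
    have heK : (P.under (𝓞 K)).ramificationIdx ℤ = e :=
      (ramificationIdxIn_eq_ramificationIdx _ _ Gal(K/ℚ)).symm
    have heK' : (P.under (𝓞 K')).ramificationIdx ℤ = e' :=
      (ramificationIdxIn_eq_ramificationIdx _ _ Gal(K'/ℚ)).symm
    have hPK : P.ramificationIdx (𝓞 K) = e' := by
      rw [ramificationIdx_eq_ramificationIdx_under hcop hKL hKL', heK']
    have hPK' : P.ramificationIdx (𝓞 K') = e := by
      rw [ramificationIdx_eq_ramificationIdx_under hcop.symm hKL' hKL, heK]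
    have hed : e ∣ finrank ℚ K := heK ▸ ramificationIdx_int_dvd_finrank K _
    have hed' : e' ∣ finrank ℚ K' := heK' ▸ ramificationIdx_int_dvd_finrank K' _
    have hrK : finrank (𝓞 K) (𝓞 L) = finrank ℚ K' := by
      rw [← hKL, IsFractionRing.finrank_eq (𝓞 K) K (𝓞 L) L]
    have hrK' : finrank ℤ (𝓞 K') = finrank ℚ K' := RingOfIntegers.rank K'
    refine ⟨?_, ?_, ?_, fun h ↦ ?_, hed, hed'⟩
    · rw [← hPK]
      refine emultiplicity_differentIdeal_of_ramificationIdx (q := P.under (𝓞 K))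
        hq.ne_bot_of_isIntegral_int P hrK ?_
      rw [hPK]
      exact ((Nat.dvd_prime hl').mp hed').imp_right fun h ↦ ⟨h, hnmem'⟩
    · rw [emultiplicity_map_ringOfIntegers hP hdK', hPK', ← heK']
      congr 1
      refine emultiplicity_differentIdeal_of_ramificationIdx hp0 (P.under (𝓞 K')) hrK' ?_
      rw [heK']
      exact ((Nat.dvd_prime hl').mp hed').imp_right fun h ↦ ⟨h, by exact_mod_cast hnmem⟩
    · rw [emultiplicity_map_ringOfIntegers hP hdK, hPK, ← heK]
      gcongr
      exact ramificationIdx_sub_one_le_emultiplicity_differentIdeal hp0 _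
    · rw [emultiplicity_map_ringOfIntegers hP hdK,
        emultiplicity_differentIdeal_of_ramificationIdx hp0 (P.under (𝓞 K)) rfl
          (.inl (heK.trans h)), heK, h]
      simp
  have hfac {n : ℕ} : (n ^ finrank ℚ K).factorization p = finrank ℚ K * n.factorization p := by
    simp
  have hfac' {n : ℕ} : (n ^ finrank ℚ K').factorization p =
      finrank ℚ K' * n.factorization p := by
    simp
  have hA : e * (absNorm (differentIdeal (𝓞 K) (𝓞 L))).factorization p =
      finrank ℚ K * (discr K').natAbs.factorization p := by
    rw [← hfac, ← hN']
    refine le_antisymm ?_ ?_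
    · simpa using mul_factorization_absNorm_le hp hdL hmap' e 1 fun P hP hPp ↦ by
        obtain ⟨h1, h2, -⟩ := hlocal P hP hPp
        simp [h1, h2]
    · simpa using mul_factorization_absNorm_le hp hmap' hdL 1 e fun P hP hPp ↦ by
        obtain ⟨h1, h2, -⟩ := hlocal P hP hPp
        simp [h1, h2]
  have hB := mul_factorization_absNorm_le hp hmap' hmap ((e - 1) * e') (e * (e' - 1))
    fun P hP hPp ↦ by
      obtain ⟨-, h2, h3, -⟩ := hlocal P hP hPp
      rw [h2]
      calc ((((e - 1) * e' : ℕ) : ℕ∞)) * (e * (e' - 1 : ℕ))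
          = ((e * (e' - 1) : ℕ) : ℕ∞) * (e' * (e - 1 : ℕ)) := by push_cast; ring
        _ ≤ _ := by gcongr
  have hC (h : e = 1) := mul_factorization_absNorm_le hp hmap hmap 1 0 fun P hP hPp ↦ by
    simp [(hlocal P hP hPp).2.2.2.1 h]
  rw [hN, hN', Nat.factorization_pow, Nat.factorization_pow, Finsupp.smul_apply,
    Finsupp.smul_apply, smul_eq_mul, smul_eq_mul] at hB
  rw [hN, hfac'] at hC
  have hvL : (discr L).natAbs.factorization p =
      (absNorm (differentIdeal (𝓞 K) (𝓞 L))).factorization p +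
        finrank ℚ K' * (discr K).natAbs.factorization p := by
    rw [hDL, hKL, Nat.factorization_mul (by rwa [Ne, absNorm_eq_zero_iff])
      (pow_ne_zero _ (by simp [discr_ne_zero])), Finsupp.add_apply, hfac']
  have : (span {(p : ℤ)}).IsMaximal :=
    ((span_singleton_prime (by simpa using hp.ne_zero)).mpr
      (Nat.prime_iff_prime_int.mp hp)).isMaximal (by simpa using hp.ne_zero)
  obtain ⟨P, hP, hPp⟩ := exists_maximal_ideal_liesOver_of_isIntegral (S := 𝓞 L) (span {(p : ℤ)})
  obtain ⟨-, -, -, -, hed, hed'⟩ := hlocal P hP hPp.over.symm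
  clear_value e e'
  generalize (discr K).natAbs.factorization p = v at *
  generalize (discr K').natAbs.factorization p = v' at *
  generalize (discr L).natAbs.factorization p = w at *
  generalize (absNorm (differentIdeal (𝓞 K) (𝓞 L))).factorization p = d at *
  rcases (Nat.dvd_prime hl).mp hed with rfl | rfl
  · left
    have hv : v = 0 := by
      have := hC rfl
      simpa [hl'.ne_zero] using this
    subst hv
    rw [hvL, ← hA]
    simp
  · right
    have hd : d = v' := Nat.eq_of_mul_eq_mul_left hl.pos hA
    refine ⟨by rw [hvL, hd, add_comm], ?_⟩
    rcases (Nat.dvd_prime hl').mp hed' with rfl | rfl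
    · have : v' = 0 := by
        have h1 : finrank ℚ K - 1 ≠ 0 := by have := hl.two_le; lia
        simpa [h1, hl.ne_zero] using hB
      simp [this]
    · refine Nat.le_of_mul_le_mul_left ?_ (mul_pos hl.pos hl'.pos)
      calc _ = _ := ?_
        _ ≤ _ := hB
        _ = _ := ?_
      all_goals ring

end NumberField

/-- For a cyclic sextic field `L₆` with cubic subfield `L₃` and quadratic subfield `L₂`,
`D_{L₆} / D_{L₃} = lcm(D_{L₂}³, D_{L₂} · D_{L₃})`, i.e.
`D_{L₆} = D_{L₃} · lcm(D_{L₂}³, D_{L₂} · D_{L₃})`. -/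
theorem discr_cyclic_sextic (L : Type) [Field L] [NumberField L]
    [IsGalois ℚ L]
    (hgal : Nonempty ((L ≃ₐ[ℚ] L) ≃* Multiplicative (ZMod 6)))
    (L₃ L₂ : IntermediateField ℚ L)
    [NumberField ↥L₃] [NumberField ↥L₂]
    (hr3 : Module.finrank ℚ ↥L₃ = 3) (hr2 : Module.finrank ℚ ↥L₂ = 2) :
    (NumberField.discr L).natAbs
      = (NumberField.discr ↥L₃).natAbs *
        Nat.lcm ((NumberField.discr ↥L₂).natAbs ^ 3)
          ((NumberField.discr ↥L₂).natAbs * (NumberField.discr ↥L₃).natAbs) := by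
  have : IsCyclic Gal(L/ℚ) := isCyclic_of_surjective hgal.some.symm hgal.some.symm.surjective
  have : IsAbelianGalois ℚ L := .of_isCyclic ℚ L
  have : IsAbelianGalois ℚ L₃ := .tower_bot ℚ L₃ L
  have : IsAbelianGalois ℚ L₂ := .tower_bot ℚ L₂ L
  have h6 : finrank ℚ L = 6 := by
    rw [← IsGalois.card_aut_eq_finrank, Nat.card_congr hgal.some.toEquiv]
    simp
  have h3L : finrank L₃ L = finrank ℚ L₂ := by
    have := finrank_mul_finrank ℚ L₃ L
    lia
  have h2L : finrank L₂ L = finrank ℚ L₃ := by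
    have := finrank_mul_finrank ℚ L₂ L
    lia
  have hD (F : Type) [Field F] [NumberField F] : (discr F).natAbs ≠ 0 := by simp [discr_ne_zero]
  have hlcm := Nat.lcm_ne_zero (pow_ne_zero 3 (hD L₂)) (mul_ne_zero (hD L₂) (hD L₃))
  refine Nat.eq_of_factorization_eq (hD L) (mul_ne_zero (hD L₃) hlcm) fun p ↦ ?_
  by_cases hp : p.Prime
  swap
  · simp [Nat.factorization_eq_zero_of_not_prime _ hp]
  rw [Nat.factorization_mul (hD L₃) hlcm, Nat.factorization_lcm (pow_ne_zero 3 (hD L₂))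
    (mul_ne_zero (hD L₂) (hD L₃)), Nat.factorization_mul (hD L₂) (hD L₃), Nat.factorization_pow]
  simp only [Finsupp.add_apply, Finsupp.sup_apply, Finsupp.smul_apply, smul_eq_mul]
  by_cases h3 : p = 3
  · have := factorization_discr_of_ne (K := L₃) (K' := L₂) (L := L) hp (hr3 ▸ Nat.prime_three)
      (hr2 ▸ Nat.prime_two) (by lia) h3L h2L (by lia)
    rw [hr3, hr2] at this
    lia
  · have := factorization_discr_of_ne (K := L₂) (K' := L₃) (L := L) hp (hr2 ▸ Nat.prime_two)
      (hr3 ▸ Nat.prime_three) (by lia) h2L h3L (by lia)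
    rw [hr3, hr2] at this
    lia
end
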